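/- arXiv:2504.16887 — 8 statements merged into one kernel-verified Lean document; each statement's English description precedes it below -/
import Mathlib

section
/- For every natural number L, the map Φ : F_L → F_L defined by Φ(f)(s) = f(fix_f(s)) for s ∈ S_L is a bijection of the finite set F_L. (Consequently, if f is uniformly distributed on F_L, then so is f ∘ fix_f.) -/
/-- Blockwise XOR on blocks `B = Fin r → Bool`. -/
def blockXor {r : ℕ} (a b : Fin r → Bool) : Fin r → Bool := fun i => xor (a i) (b i)

/-- Auxiliary recursion for `fixF`, working on the *reversed* string
(so the head of the list is the last block of the string). -/
def fixAux {r : ℕ} (f : List (Fin r → Bool) → (Fin r → Bool)) :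
    List (Fin r → Bool) → List (Fin r → Bool)
  | [] => []
  | [x] => [x]
  | x :: xs => blockXor x (f (fixAux f xs).reverse) :: fixAux f xs

/-- The map `fix_f`: `fix_f(ε) = ε`, `fix_f([x₁]) = [x₁]`, and for nonempty `t`,
`fix_f(t ∥ [x]) = fix_f(t) ∥ [x ⊕ f(fix_f(t))]`. -/
def fixF {r : ℕ} (f : List (Fin r → Bool) → (Fin r → Bool))
    (l : List (Fin r → Bool)) : List (Fin r → Bool) :=
  (fixAux f l.reverse).reverse

theorem fixAux_length {r : ℕ} (f : List (Fin r → Bool) → (Fin r → Bool)) :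
    ∀ l : List (Fin r → Bool), (fixAux f l).length = l.length
  | [] => rfl
  | [_] => rfl
  | _ :: y :: xs => by
    simp only [fixAux, List.length_cons]
    rw [fixAux_length f (y :: xs), List.length_cons]

/-- `fix_f` preserves the length of strings. -/
theorem fixF_length {r : ℕ} (f : List (Fin r → Bool) → (Fin r → Bool))
    (l : List (Fin r → Bool)) : (fixF f l).length = l.length := by
  simp [fixF, fixAux_length]

/-- Strings of block length at most `L`. -/
abbrev SL (r L : ℕ) := {l : List (Fin r → Bool) // l.length ≤ L}

/-- Extension of a function on `S_L` to all strings (arbitrary default value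
outside `S_L`; computing `fix_f` on a string of length `≤ L` only evaluates `f`
on strings of length `< L`, so the choice of default is irrelevant). -/
def extendF {r : ℕ} (L : ℕ) (f : SL r L → (Fin r → Bool)) :
    List (Fin r → Bool) → (Fin r → Bool) :=
  fun l => if h : l.length ≤ L then f ⟨l, h⟩ else fun _ => false

/-- The map `Φ : F_L → F_L`, `Φ(f)(s) = f(fix_f(s))`. -/
def PhiL {r : ℕ} (L : ℕ) (f : SL r L → (Fin r → Bool)) :
    SL r L → (Fin r → Bool) :=
  fun s => f ⟨fixF (extendF L f) s.1, by rw [fixF_length]; exact s.2⟩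

theorem blockXor_cancel_right {r : ℕ} (a b : Fin r → Bool) :
    blockXor (blockXor a b) b = a := by
  funext i
  simp [blockXor]

theorem fixAux_cons_of_ne_nil {r : ℕ} (f : List (Fin r → Bool) → (Fin r → Bool))
    (x : Fin r → Bool) {xs : List (Fin r → Bool)} (h : xs ≠ []) :
    fixAux f (x :: xs) = blockXor x (f (fixAux f xs).reverse) :: fixAux f xs := by
  cases xs with
  | nil => exact absurd rfl h
  | cons y ys => rfl

theorem fixAux_surjective {r : ℕ} (f : List (Fin r → Bool) → (Fin r → Bool)) :
    Function.Surjective (fixAux f) := by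
  intro l
  induction l with
  | nil => exact ⟨[], rfl⟩
  | cons y ys ih =>
    obtain ⟨xs, rfl⟩ := ih
    by_cases h : xs = []
    · subst h
      exact ⟨[y], rfl⟩
    · exact ⟨blockXor y (f (fixAux f xs).reverse) :: xs, by
        rw [fixAux_cons_of_ne_nil f _ h, blockXor_cancel_right]⟩

theorem fixF_surjective {r : ℕ} (f : List (Fin r → Bool) → (Fin r → Bool)) :
    Function.Surjective (fixF f) :=
  List.reverse_surjective.comp ((fixAux_surjective f).comp List.reverse_surjective)

theorem PhiL_apply {r L : ℕ} (f : SL r L → (Fin r → Bool)) (s : SL r L) :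
    PhiL L f s = extendF L f (fixF (extendF L f) s.1) := by
  have h : (fixF (extendF L f) s.1).length ≤ L := by rw [fixF_length]; exact s.2
  rw [extendF, dif_pos h, PhiL]

/-- On strings of length at most `L`, `fix_f` depends only on `Φ(f)`. -/
theorem fixAux_extendF_eq_of_PhiL_eq {r L : ℕ} {f g : SL r L → (Fin r → Bool)}
    (h : PhiL L f = PhiL L g) (l : List (Fin r → Bool)) (hl : l.length ≤ L) :
    fixAux (extendF L f) l = fixAux (extendF L g) l := by
  induction l with
  | nil => rfl
  | cons x xs ih =>
    have hxs : xs.length ≤ L := (Nat.le_succ _).trans hl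
    by_cases hne : xs = []
    · subst hne
      rfl
    · have key := congrFun h ⟨xs.reverse, by simpa using hxs⟩
      simp only [PhiL_apply, fixF, List.reverse_reverse] at key
      rw [fixAux_cons_of_ne_nil _ _ hne, fixAux_cons_of_ne_nil _ _ hne, key, ih hxs]

theorem PhiL_injective {r : ℕ} (L : ℕ) : Function.Injective (PhiL (r := r) L) := by
  intro f g h
  funext s
  obtain ⟨t, ht⟩ := fixF_surjective (extendF L f) s.1
  have htL : t.length ≤ L := by rw [← fixF_length (extendF L f), ht]; exact s.2
  have ht' : fixF (extendF L g) t = s.1 := by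
    rw [← ht, fixF, fixF,
      fixAux_extendF_eq_of_PhiL_eq h t.reverse (by simpa using htL)]
  have key := congrFun h ⟨t, htL⟩
  simpa only [PhiL, ht, ht'] using key

/-- For every `L`, the map `Φ(f) = f ∘ fix_f` is a bijection of
the finite set `F_L` of functions from strings of length at most `L` to blocks. -/
theorem PhiL_bijective {r : ℕ} (hr : 0 < r) (L : ℕ) :
    Function.Bijective (PhiL (r := r) L) := by
  have : Finite (SL r L) := (List.finite_length_le (Fin r → Bool) L).to_subtype
  exact Finite.injective_iff_bijective.mp (PhiL_injective L)
end

section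
/- Let n be a natural number, N = 2^n, and X, Y ⊆ Fin N. Set m = |X|·|Y|/N (a real number). Then for every real u with u ≥ 6m, the probability over a uniformly random permutation π of Fin N that |{a ∈ X : π(a) ∈ Y}| ≥ m + u is at most exp(−(3/4)·u); equivalently, the number of permutations π of Fin N with |{a ∈ X : π(a) ∈ Y}| ≥ m + u is at most N! · exp(−(3/4)·u). -/
open Finset in
/-- If `x ∉ X`, the weight `c ^ |X ∩ π⁻¹ Y|` correlates least with the event `π x ∈ Y`. -/
theorem sum_perm_pow_mul_indicator_le {α : Type*} [Fintype α] [DecidableEq α]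
    (X Y : Finset α) {x : α} (hx : x ∉ X) (y : α) {c : ℝ} (hc : 1 ≤ c) :
    ∑ π : Equiv.Perm α, c ^ #{a ∈ X | π a ∈ Y} * (if π x ∈ Y then (1 : ℝ) else 0) ≤
      ∑ π : Equiv.Perm α, c ^ #{a ∈ X | π a ∈ Y} * (if π y ∈ Y then (1 : ℝ) else 0) := by
  rw [← Equiv.sum_comp (Equiv.mulRight (Equiv.swap x y))]
  refine sum_le_sum fun π _ => ?_
  simp only [Equiv.coe_mulRight, Equiv.Perm.coe_mul, Function.comp_apply, Equiv.swap_apply_left]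
  split_ifs with hy
  · rw [mul_one, mul_one]
    refine pow_le_pow_right₀ hc (card_le_card fun a ha => ?_)
    replace ha := mem_filter.mp ha
    refine mem_filter.mpr ⟨ha.1, ?_⟩
    by_cases hay : a = y
    · rwa [hay]
    · have hax : a ≠ x := fun h => hx (h ▸ ha.1)
      simpa [Equiv.swap_apply_of_ne_of_ne hax hay] using ha.2
  · simp

open Finset in
theorem card_mul_sum_perm_pow_mul_indicator_le {α : Type*} [Fintype α] [DecidableEq α]
    (X Y : Finset α) {x : α} (hx : x ∉ X) {c : ℝ} (hc : 1 ≤ c) :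
    (Fintype.card α : ℝ) *
        ∑ π : Equiv.Perm α, c ^ #{a ∈ X | π a ∈ Y} * (if π x ∈ Y then (1 : ℝ) else 0) ≤
      #Y * ∑ π : Equiv.Perm α, c ^ #{a ∈ X | π a ∈ Y} := by
  have hcount (π : Equiv.Perm α) : ∑ y, (if π y ∈ Y then (1 : ℝ) else 0) = #Y := by
    rw [Equiv.sum_comp π fun z => if z ∈ Y then (1 : ℝ) else 0]
    simp
  calc _ = ∑ _y : α,
        ∑ π : Equiv.Perm α, c ^ #{a ∈ X | π a ∈ Y} * (if π x ∈ Y then (1 : ℝ) else 0) := by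
        rw [sum_const, card_univ, nsmul_eq_mul]
    _ ≤ ∑ y : α,
        ∑ π : Equiv.Perm α, c ^ #{a ∈ X | π a ∈ Y} * (if π y ∈ Y then (1 : ℝ) else 0) :=
        sum_le_sum fun y _ => sum_perm_pow_mul_indicator_le X Y hx y hc
    _ = _ := by
        rw [sum_comm, mul_sum]
        refine sum_congr rfl fun π _ => ?_
        rw [← mul_sum, hcount, mul_comm]

open Finset in
/-- The moment generating function of `|X ∩ π⁻¹ Y|` is at most that of a binomial variable. -/
theorem sum_perm_pow_card_filter_le {α : Type*} [Fintype α] [DecidableEq α]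
    (X Y : Finset α) {c : ℝ} (hc : 1 ≤ c) :
    ∑ π : Equiv.Perm α, c ^ #{a ∈ X | π a ∈ Y} ≤
      (Fintype.card α).factorial * (1 + (c - 1) * (#Y / Fintype.card α)) ^ #X := by
  induction X using Finset.induction_on with
  | empty => simp [Fintype.card_perm]
  | insert x X hx ih =>
    have hcard : (0 : ℝ) < Fintype.card α := by
      exact_mod_cast Fintype.card_pos_iff.mpr ⟨x⟩
    have hstep : ∑ π : Equiv.Perm α, c ^ #{a ∈ insert x X | π a ∈ Y} =
        ∑ π : Equiv.Perm α, c ^ #{a ∈ X | π a ∈ Y} + (c - 1) *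
          ∑ π : Equiv.Perm α, c ^ #{a ∈ X | π a ∈ Y} * (if π x ∈ Y then (1 : ℝ) else 0) := by
      rw [mul_sum, ← sum_add_distrib]
      refine sum_congr rfl fun π _ => ?_
      rw [filter_insert]
      split_ifs
      · rw [card_insert_of_notMem (by simp [hx]), pow_succ]
        ring
      · simp
    have hind : ∑ π : Equiv.Perm α, c ^ #{a ∈ X | π a ∈ Y} * (if π x ∈ Y then (1 : ℝ) else 0) ≤
        #Y / Fintype.card α * ∑ π : Equiv.Perm α, c ^ #{a ∈ X | π a ∈ Y} := by
      rw [div_mul_eq_mul_div, le_div_iff₀' hcard]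
      exact card_mul_sum_perm_pow_mul_indicator_le X Y hx hc
    have hc' : 0 ≤ c - 1 := sub_nonneg.mpr hc
    rw [hstep, card_insert_of_notMem hx, pow_succ, ← mul_assoc]
    calc _ ≤ _ := add_le_add_right (mul_le_mul_of_nonneg_left hind hc') _
      _ = (∑ π : Equiv.Perm α, c ^ #{a ∈ X | π a ∈ Y}) *
          (1 + (c - 1) * (#Y / Fintype.card α)) := by ring
      _ ≤ _ := mul_le_mul_of_nonneg_right ih (by positivity)


/-- Tail bound: with `N = 2^n`, `X, Y ⊆ Fin N`, `m = |X|·|Y|/N`,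
and `u ≥ 6m`, the number of permutations `π` of `Fin N` with
`|{a ∈ X : π a ∈ Y}| ≥ m + u` is at most `N! · exp(−(3/4)·u)`; equivalently, the
probability of this event over a uniformly random permutation is at most
`exp(−(3/4)·u)`. -/
theorem perm_image_inter_tail_bound (n N : ℕ) (hN : N = 2 ^ n)
    (X Y : Finset (Fin N)) (m : ℝ) (hm : m = (X.card : ℝ) * Y.card / N)
    (u : ℝ) (hu : 6 * m ≤ u) :
    (Nat.card {π : Equiv.Perm (Fin N) //
        m + u ≤ ((X.filter fun a => π a ∈ Y).card : ℝ)} : ℝ)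
      ≤ (Nat.factorial N : ℝ) * Real.exp (-(3 / 4) * u) := by
  have hm0 : 0 ≤ m := by rw [hm]; positivity
  have hmgf : ∑ π : Equiv.Perm (Fin N), Real.exp 1 ^ (X.filter fun a => π a ∈ Y).card ≤
      N.factorial * Real.exp ((Real.exp 1 - 1) * m) := by
    have he : 1 ≤ Real.exp 1 := Real.one_le_exp zero_le_one
    have he' : 0 ≤ Real.exp 1 - 1 := sub_nonneg.mpr he
    refine (sum_perm_pow_card_filter_le X Y he).trans ?_
    rw [Fintype.card_fin]
    gcongr
    calc (1 + (Real.exp 1 - 1) * ((Y.card : ℝ) / N)) ^ X.card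
        ≤ Real.exp ((Real.exp 1 - 1) * ((Y.card : ℝ) / N)) ^ X.card := by
          gcongr
          rw [add_comm]
          exact Real.add_one_le_exp _
      _ = _ := by
          rw [← Real.exp_nat_mul, hm]
          congr 1
          ring
  have hmarkov : (Nat.card {π : Equiv.Perm (Fin N) //
        m + u ≤ ((X.filter fun a => π a ∈ Y).card : ℝ)} : ℝ) * Real.exp (m + u) ≤
      ∑ π : Equiv.Perm (Fin N), Real.exp 1 ^ (X.filter fun a => π a ∈ Y).card := by
    classical
    rw [Nat.card_eq_fintype_card, Fintype.card_subtype, ← nsmul_eq_mul]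
    refine (Finset.card_nsmul_le_sum _ _ _ fun π hπ => ?_).trans
      (Finset.sum_le_sum_of_subset_of_nonneg (Finset.filter_subset _ _)
        fun _ _ _ => by positivity)
    rw [← Real.exp_nat_mul, mul_one]
    exact Real.exp_le_exp.mpr (Finset.mem_filter.mp hπ).2
  have hexp : (Real.exp 1 - 1) * m ≤ -(3 / 4) * u + (m + u) := by
    nlinarith [mul_nonneg hm0 (sub_nonneg.mpr Real.exp_one_lt_d9.le)]
  refine le_of_mul_le_mul_right (hmarkov.trans (hmgf.trans ?_)) (Real.exp_pos (m + u))
  rw [mul_assoc, ← Real.exp_add]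
  gcongr
end

section
/- Let n be a natural number and N = 2^n. Let X₁, …, X_l be pairwise disjoint subsets of Fin N whose union is Fin N with |X_i| = x for all i, and let Y₁, …, Y_k be pairwise disjoint subsets of Fin N whose union is Fin N with |Y_j| = y for all j. Set m = x·y/N (a real number). Then the probability over a uniformly random permutation π of Fin N that there exist i ∈ [l] and j ∈ [k] with |{a ∈ X_i : π(a) ∈ Y_j}| ≥ 7m + 3n is at most 2^{−n}; equivalently, the number of such permutations is at most N!/2^n. -/
open Finset in
/-- Extending the set of points constrained to land in `Y` by one point multiplies the number of
permutations by at most the density of `Y`. -/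
theorem card_perm_insert_mapsTo_mul_le {α : Type*} [Fintype α] [DecidableEq α]
    (Y S : Finset α) {a : α} (ha : a ∉ S) :
    #{π : Equiv.Perm α | ∀ b ∈ insert a S, π b ∈ Y} * Fintype.card α ≤
      #{π : Equiv.Perm α | ∀ b ∈ S, π b ∈ Y} * #Y := by
  set A : Finset (Equiv.Perm α) := {π | ∀ b ∈ S, π b ∈ Y} with hA
  have hswap : ∀ b ∈ Sᶜ, #{π ∈ A | π b ∈ Y} =
      #{π : Equiv.Perm α | ∀ b ∈ insert a S, π b ∈ Y} := by
    intro b hb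
    rw [mem_compl] at hb
    have hfix : ∀ c ∈ S, Equiv.swap a b c = c := fun c hc =>
      Equiv.swap_apply_of_ne_of_ne (fun h => ha (h ▸ hc)) (fun h => hb (h ▸ hc))
    refine card_bij' (fun π _ => π * Equiv.swap a b) (fun π _ => π * Equiv.swap a b) ?_ ?_ ?_ ?_
    · intro π hπ
      simp only [hA, mem_filter, mem_univ, true_and] at hπ
      simp only [mem_filter, mem_univ, true_and, mem_insert, Equiv.Perm.mul_apply]
      rintro c (rfl | hc)
      · simpa using hπ.2
      · rw [hfix c hc]
        exact hπ.1 c hc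
    · intro π hπ
      simp only [mem_filter, mem_univ, true_and, mem_insert] at hπ
      simp only [hA, mem_filter, mem_univ, true_and, Equiv.Perm.mul_apply]
      refine ⟨fun c hc => ?_, ?_⟩
      · rw [hfix c hc]
        exact hπ c (Or.inr hc)
      · simpa using hπ a (Or.inl rfl)
    · intro π _
      simp [mul_assoc]
    · intro π _
      simp [mul_assoc]
  have hcount : ∀ π ∈ A, #S + #{b ∈ Sᶜ | π b ∈ Y} = #Y := by
    intro π hπ
    simp only [hA, mem_filter, mem_univ, true_and] at hπ
    have hS : {b ∈ S | π b ∈ Y} = S := filter_true_of_mem hπ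
    have hY : #{b : α | π b ∈ Y} = #Y :=
      card_bij (fun b _ => π b) (by simp) (by simp) fun c hc => ⟨π.symm c, by simpa using hc, by simp⟩
    rw [← hY, ← union_compl S, filter_union, card_union_of_disjoint
      (disjoint_filter_filter disjoint_compl_right), hS]
  have hdouble : #Sᶜ * #{π : Equiv.Perm α | ∀ b ∈ insert a S, π b ∈ Y} =
      ∑ π ∈ A, #{b ∈ Sᶜ | π b ∈ Y} := by
    rw [← smul_eq_mul, ← sum_const, ← sum_congr rfl hswap]
    simp only [card_filter]
    exact sum_comm
  have hsum : #A * #S + ∑ π ∈ A, #{b ∈ Sᶜ | π b ∈ Y} = #A * #Y := by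
    rw [← smul_eq_mul, ← smul_eq_mul, ← sum_const, ← sum_const, ← sum_add_distrib]
    exact sum_congr rfl hcount
  have hle : #{π : Equiv.Perm α | ∀ b ∈ insert a S, π b ∈ Y} ≤ #A := by
    refine card_le_card fun π hπ => ?_
    simp only [mem_filter, mem_univ, true_and, mem_insert] at hπ
    simpa [hA] using fun c hc => hπ c (Or.inr hc)
  have hS := card_add_card_compl S
  have := Nat.mul_le_mul_right #S hle
  rw [← hS]
  linarith

open Finset in
theorem card_perm_mapsTo_mul_pow_le {α : Type*} [Fintype α] [DecidableEq α] (Y S : Finset α) :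
    #{π : Equiv.Perm α | ∀ b ∈ S, π b ∈ Y} * Fintype.card α ^ #S ≤
      (Fintype.card α).factorial * #Y ^ #S := by
  induction S using Finset.induction_on with
  | empty => simp [Fintype.card_perm]
  | insert a S ha ih =>
    rw [card_insert_of_notMem ha, pow_succ', pow_succ', ← mul_assoc]
    calc _ ≤ #{π : Equiv.Perm α | ∀ b ∈ S, π b ∈ Y} * #Y * Fintype.card α ^ #S :=
          Nat.mul_le_mul_right _ (card_perm_insert_mapsTo_mul_le Y S ha)
      _ = #{π : Equiv.Perm α | ∀ b ∈ S, π b ∈ Y} * Fintype.card α ^ #S * #Y := by ring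
      _ ≤ (Fintype.card α).factorial * #Y ^ #S * #Y := Nat.mul_le_mul_right _ ih
      _ = _ := by ring

open Finset in
/-- The exponential moment, at base `2`, of the number of points of `X` that a uniformly random
permutation sends to `Y` is at most `exp (|X| |Y| / |α|)`. -/
theorem sum_perm_two_pow_card_filter_le {α : Type*} [Fintype α] [DecidableEq α] [Nonempty α]
    (X Y : Finset α) :
    ∑ π : Equiv.Perm α, (2 : ℝ) ^ #{a ∈ X | π a ∈ Y} ≤
      (Fintype.card α).factorial * Real.exp (#X * #Y / Fintype.card α) := by
  have hN : (0 : ℝ) < Fintype.card α := by exact_mod_cast Fintype.card_pos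
  have hexpand : ∀ π : Equiv.Perm α, (2 : ℝ) ^ #{a ∈ X | π a ∈ Y} =
      ∑ S ∈ X.powerset, if ∀ b ∈ S, π b ∈ Y then 1 else 0 := by
    intro π
    have hpow : X.powerset.filter (fun S => ∀ b ∈ S, π b ∈ Y) =
        ({a ∈ X | π a ∈ Y} : Finset α).powerset := by
      ext S
      simp only [mem_filter, mem_powerset, subset_iff]
      exact ⟨fun h b hb => ⟨h.1 hb, h.2 b hb⟩, fun h => ⟨fun b hb => (h hb).1, fun b hb => (h hb).2⟩⟩
    rw [sum_boole, hpow, card_powerset]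
    norm_cast
  have hterm : ∀ S ∈ X.powerset, (#{π : Equiv.Perm α | ∀ b ∈ S, π b ∈ Y} : ℝ) ≤
      (Fintype.card α).factorial * (#Y / Fintype.card α : ℝ) ^ #S := by
    intro S _
    rw [div_pow, ← mul_div_assoc, le_div_iff₀ (by positivity)]
    exact_mod_cast card_perm_mapsTo_mul_pow_le Y S
  calc ∑ π : Equiv.Perm α, (2 : ℝ) ^ #{a ∈ X | π a ∈ Y}
      = ∑ S ∈ X.powerset, (#{π : Equiv.Perm α | ∀ b ∈ S, π b ∈ Y} : ℝ) := by
        rw [sum_congr rfl fun π _ => hexpand π, sum_comm]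
        simp only [card_filter, Nat.cast_sum, Nat.cast_ite, Nat.cast_one, Nat.cast_zero]
    _ ≤ ∑ S ∈ X.powerset, (Fintype.card α).factorial * (#Y / Fintype.card α : ℝ) ^ #S :=
        sum_le_sum hterm
    _ = (Fintype.card α).factorial * (#Y / Fintype.card α + 1 : ℝ) ^ #X := by
        rw [← mul_sum, ← sum_pow_mul_eq_add_pow]
        simp
    _ ≤ (Fintype.card α).factorial * Real.exp (#Y / Fintype.card α) ^ #X := by
        gcongr
        exact Real.add_one_le_exp _
    _ = _ := by
        rw [← Real.exp_nat_mul, mul_div_assoc]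

open Finset in
/-- A Chernoff bound for the number of points of `X` that a permutation sends to `Y`. -/
theorem card_perm_le_card_filter_le {α : Type*} [Fintype α] [DecidableEq α] [Nonempty α]
    (X Y : Finset α) (s : ℕ) :
    (#{π : Equiv.Perm α | 7 * (#X * #Y / Fintype.card α : ℝ) + s ≤ #{a ∈ X | π a ∈ Y}} : ℝ) ≤
      (Fintype.card α).factorial / 2 ^ s := by
  set m : ℝ := #X * #Y / Fintype.card α with hm
  have hm0 : 0 ≤ m := by positivity
  rw [le_div_iff₀ (by positivity)]
  have hmarkov : (#{π : Equiv.Perm α | 7 * m + s ≤ #{a ∈ X | π a ∈ Y}} : ℝ) *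
      (Real.exp m * 2 ^ s) ≤ (Fintype.card α).factorial * Real.exp m := by
    refine le_trans ?_ (sum_perm_two_pow_card_filter_le X Y)
    rw [← nsmul_eq_mul, ← sum_const]
    refine le_trans (sum_le_sum fun π hπ => ?_)
      (sum_le_univ_sum_of_nonneg fun π => by positivity)
    simp only [mem_filter, mem_univ, true_and] at hπ
    have hlog : (1 : ℝ) ≤ 7 * Real.log 2 := by
      linarith [Real.log_two_gt_d9]
    have hexp : Real.exp m ≤ (2 : ℝ) ^ (7 * m) := by
      rw [Real.rpow_def_of_pos two_pos]
      exact Real.exp_le_exp.2 (by nlinarith)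
    calc Real.exp m * 2 ^ s ≤ (2 : ℝ) ^ (7 * m) * 2 ^ s := by gcongr
      _ = (2 : ℝ) ^ (7 * m + s) := by rw [Real.rpow_add two_pos, Real.rpow_natCast]
      _ ≤ (2 : ℝ) ^ (#{a ∈ X | π a ∈ Y} : ℝ) := Real.rpow_le_rpow_of_exponent_le one_le_two hπ
      _ = _ := Real.rpow_natCast _ _
  have hpos := Real.exp_pos m
  refine le_of_mul_le_mul_right ?_ hpos
  linarith

/-- A family of pairwise disjoint nonempty finsets is no larger than its ground type. -/
theorem card_le_card_of_pairwise_disjoint_nonempty {ι α : Type*} [Fintype ι] [Fintype α]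
    (X : ι → Finset α) (hdisj : ∀ i i', i ≠ i' → Disjoint (X i) (X i'))
    (hne : ∀ i, (X i).Nonempty) : Fintype.card ι ≤ Fintype.card α := by
  choose f hf using hne
  refine Fintype.card_le_of_injective f fun i i' h => ?_
  by_contra hii
  exact Finset.disjoint_left.1 (hdisj i i' hii) (hf i) (h ▸ hf i')


/-- With `N = 2^n`, a partition of `Fin N` into parts `X i` of equal
size `x` and a partition into parts `Y j` of equal size `y`, and `m = x·y/N`, the
number of permutations `π` of `Fin N` such that some pair `(i, j)` satisfies
`|{a ∈ X i : π a ∈ Y j}| ≥ 7m + 3n` is at most `N!/2^n`; equivalently, the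
probability of this event over a uniformly random permutation is at most `2^{-n}`. -/
theorem perm_partition_max_bound (n l k x y N : ℕ) (hN : N = 2 ^ n)
    (X : Fin l → Finset (Fin N)) (Y : Fin k → Finset (Fin N))
    (hXdisj : ∀ i i', i ≠ i' → Disjoint (X i) (X i'))
    (hXcover : ∀ a : Fin N, ∃ i, a ∈ X i)
    (hXcard : ∀ i, (X i).card = x)
    (hYdisj : ∀ j j', j ≠ j' → Disjoint (Y j) (Y j'))
    (hYcover : ∀ a : Fin N, ∃ j, a ∈ Y j)
    (hYcard : ∀ j, (Y j).card = y)
    (m : ℝ) (hm : m = (x : ℝ) * y / N) :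
    (Nat.card {π : Equiv.Perm (Fin N) // ∃ i j,
        7 * m + 3 * n ≤ (((X i).filter fun a => π a ∈ Y j).card : ℝ)} : ℝ)
      ≤ (Nat.factorial N : ℝ) / 2 ^ n := by
  classical
  subst hN
  have hpos : 0 < 2 ^ n := by positivity
  have : Nonempty (Fin (2 ^ n)) := ⟨⟨0, hpos⟩⟩
  obtain ⟨i₀, hi₀⟩ := hXcover ⟨0, hpos⟩
  obtain ⟨j₀, hj₀⟩ := hYcover ⟨0, hpos⟩
  have hl : l ≤ 2 ^ n := by
    simpa using card_le_card_of_pairwise_disjoint_nonempty X hXdisj fun i => by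
      rw [← Finset.card_pos, hXcard i, ← hXcard i₀]
      exact Finset.card_pos.2 ⟨_, hi₀⟩
  have hk : k ≤ 2 ^ n := by
    simpa using card_le_card_of_pairwise_disjoint_nonempty Y hYdisj fun j => by
      rw [← Finset.card_pos, hYcard j, ← hYcard j₀]
      exact Finset.card_pos.2 ⟨_, hj₀⟩
  let E : Fin l × Fin k → Finset (Equiv.Perm (Fin (2 ^ n))) := fun p =>
    Finset.univ.filter fun π =>
      7 * m + 3 * n ≤ (((X p.1).filter fun a => π a ∈ Y p.2).card : ℝ)
  have hE : ∀ p ∈ Finset.univ, ((E p).card : ℝ) ≤ ((2 ^ n).factorial : ℝ) / 2 ^ (3 * n) := by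
    intro p _
    have h := card_perm_le_card_filter_le (X p.1) (Y p.2) (3 * n)
    rw [hXcard, hYcard, Fintype.card_fin, ← hm] at h
    convert h using 6
    push_cast
    rfl
  have hunion : Nat.card {π : Equiv.Perm (Fin (2 ^ n)) // ∃ i j,
      7 * m + 3 * n ≤ (((X i).filter fun a => π a ∈ Y j).card : ℝ)} ≤
      ∑ p, (E p).card := by
    rw [Nat.card_eq_fintype_card, Fintype.card_subtype]
    refine le_trans (Finset.card_le_card fun π hπ => ?_) Finset.card_biUnion_le
    simpa [E] using hπ
  have hlk : (l : ℝ) * k ≤ 2 ^ n * 2 ^ n := by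
    exact_mod_cast Nat.mul_le_mul hl hk
  refine le_trans (Nat.cast_le.2 hunion) ?_
  rw [Nat.cast_sum]
  calc ∑ p, ((E p).card : ℝ)
      ≤ (l * k : ℝ) * (((2 ^ n).factorial : ℝ) / 2 ^ (3 * n)) := by
        refine (Finset.sum_le_card_nsmul _ _ _ hE).trans_eq ?_
        simp
    _ ≤ (2 ^ n * 2 ^ n) * (((2 ^ n).factorial : ℝ) / 2 ^ (3 * n)) := by gcongr
    _ = _ := by
        rw [pow_mul']
        field_simp
end

section
/- Fix positive integers r, c with n = r + c, a permutation π of (Fin n → Bool), and databases D_k, D_{k'}. Let t ∈ ℕ and suppose (D_k, D_{k'}) is good with |D_k| ≤ t and |D_{k'}| ≤ t. Then the number of capacity strings having a tail is at most t + 1, and |IP(D_k, D_{k'})| ≤ t·(t + 1). -/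
/-! Sponge databases, tails, intermediate pairs, and goodness (common setup). -/

/-- Rate strings. -/
abbrev RateStr (r : ℕ) := Fin r → Bool
/-- Capacity strings. -/
abbrev CapStr (c : ℕ) := Fin c → Bool

/-- Bitwise XOR on capacity strings. -/
def capXor {c : ℕ} (a b : CapStr c) : CapStr c := fun i => xor (a i) (b i)

/-- The first `r` bits of an `(r+c)`-bit string. -/
def firstR {r c : ℕ} (w : Fin (r + c) → Bool) : RateStr r := fun i => w (Fin.castAdd c i)

/-- The last `c` bits of an `(r+c)`-bit string. -/
def lastC {r c : ℕ} (w : Fin (r + c) → Bool) : CapStr c := fun i => w (Fin.natAdd r i)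

/-- A database: a finite partial function from rate strings to capacity strings. -/
abbrev Database (r c : ℕ) := RateStr r → Option (CapStr c)

/-- The number of inputs on which a database is defined. -/
def dbSize {r c : ℕ} (D : Database r c) : ℕ :=
  (Finset.univ.filter fun x => (D x).isSome).card

/-- The relation "`z` has tail `s`" (with respect to `π`, `D_k`, `D_{k'}`). -/
inductive HasTail {r c : ℕ} (π : Equiv.Perm (Fin (r + c) → Bool))
    (Dk Dk' : Database r c) : CapStr c → List (RateStr r) → Prop
  | zero : HasTail π Dk Dk' (fun _ => false) []
  | step {zp : CapStr c} {s : List (RateStr r)} {xp : RateStr r} {yp yk : CapStr c} :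
      HasTail π Dk Dk' zp s →
      Dk xp = some yp →
      Dk' (firstR (π (Fin.append xp (capXor zp yp)))) = some yk →
      HasTail π Dk Dk'
        (capXor (lastC (π (Fin.append xp (capXor zp yp)))) yk) (s ++ [xp])

/-- "`z` has a tail". -/
def HasATail {r c : ℕ} (π : Equiv.Perm (Fin (r + c) → Bool))
    (Dk Dk' : Database r c) (z : CapStr c) : Prop :=
  ∃ s, HasTail π Dk Dk' z s

/-- `(x, z)` is an intermediate pair of `(D_k, D_{k'})`. -/
def IsIP {r c : ℕ} (π : Equiv.Perm (Fin (r + c) → Bool))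
    (Dk Dk' : Database r c) (x : RateStr r) (z : CapStr c) : Prop :=
  ∃ (xp : RateStr r) (yp zp : CapStr c),
    Dk xp = some yp ∧ HasATail π Dk Dk' zp ∧
    Fin.append x z = π (Fin.append xp (capXor zp yp))

/-- The pair `(D_k, D_{k'})` is good: every capacity string has at most one tail, and
distinct intermediate pairs have distinct first components. -/
def GoodDB {r c : ℕ} (π : Equiv.Perm (Fin (r + c) → Bool))
    (Dk Dk' : Database r c) : Prop :=
  (∀ z s₁ s₂, HasTail π Dk Dk' z s₁ → HasTail π Dk Dk' z s₂ → s₁ = s₂) ∧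
  (∀ x z₁ z₂, IsIP π Dk Dk' x z₁ → IsIP π Dk Dk' x z₂ → z₁ = z₂)

theorem append_firstR_lastC {r c : ℕ} (w : Fin (r + c) → Bool) :
    Fin.append (firstR w) (lastC w) = w :=
  Fin.append_castAdd_natAdd

/-- A string with a tail is zero, or is obtained from an intermediate pair by a `D_{k'}` query. -/
theorem HasATail.eq_zero_or_exists_isIP {r c : ℕ} {π : Equiv.Perm (Fin (r + c) → Bool)}
    {Dk Dk' : Database r c} {z : CapStr c} (h : HasATail π Dk Dk' z) :
    z = (fun _ => false) ∨
      ∃ x z' y, IsIP π Dk Dk' x z' ∧ Dk' x = some y ∧ z = capXor z' y := by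
  obtain ⟨s, hs⟩ := h
  cases hs with
  | zero => exact Or.inl rfl
  | step hp hk hk' =>
    exact Or.inr ⟨_, _, _, ⟨_, _, _, hk, ⟨_, hp⟩, append_firstR_lastC _⟩, hk', rfl⟩

/-- If intermediate pairs are determined by their first components, then at most one more
capacity string has a tail than `D_{k'}` has entries. -/
theorem card_hasATail_le {r c : ℕ} {π : Equiv.Perm (Fin (r + c) → Bool)}
    {Dk Dk' : Database r c}
    (h : ∀ x z₁ z₂, IsIP π Dk Dk' x z₁ → IsIP π Dk Dk' x z₂ → z₁ = z₂) :
    Nat.card {z : CapStr c // HasATail π Dk Dk' z} ≤ dbSize Dk' + 1 := by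
  classical
  let f : RateStr r → CapStr c := fun x =>
    if hx : ∃ z, IsIP π Dk Dk' x z then capXor hx.choose ((Dk' x).getD fun _ => false)
    else fun _ => false
  rw [Nat.card_eq_fintype_card, Fintype.card_subtype]
  calc
    _ ≤ (insert (fun _ => false)
          ((Finset.univ.filter fun x => (Dk' x).isSome).image f)).card := by
      refine Finset.card_le_card fun z hz => ?_
      rw [Finset.mem_insert, Finset.mem_image]
      refine (Finset.mem_filter.1 hz).2.eq_zero_or_exists_isIP.imp_right ?_
      rintro ⟨x, z', y, hip, hy, rfl⟩
      have hx : ∃ z, IsIP π Dk Dk' x z := ⟨z', hip⟩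
      refine ⟨x, by simp [hy], ?_⟩
      simp only [f, dif_pos hx, hy, Option.getD_some, h x _ _ hx.choose_spec hip]
    _ ≤ _ := (Finset.card_insert_le _ _).trans
      (Nat.add_le_add_right Finset.card_image_le 1)

/-- An intermediate pair is determined by an entry of `D_k` and a string having a tail. -/
theorem card_isIP_le {r c : ℕ} (π : Equiv.Perm (Fin (r + c) → Bool)) (Dk Dk' : Database r c) :
    Nat.card {p : RateStr r × CapStr c // IsIP π Dk Dk' p.1 p.2} ≤
      dbSize Dk * Nat.card {z : CapStr c // HasATail π Dk Dk' z} := by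
  classical
  let g : RateStr r × CapStr c → RateStr r × CapStr c := fun q =>
    let w := π (Fin.append q.1 (capXor q.2 ((Dk q.1).getD fun _ => false)))
    (firstR w, lastC w)
  rw [Nat.card_eq_fintype_card, Fintype.card_subtype, Nat.card_eq_fintype_card,
    Fintype.card_subtype, dbSize, ← Finset.card_product]
  refine (Finset.card_le_card fun p hp => ?_).trans (Finset.card_image_le (f := g))
  obtain ⟨xp, yp, zp, hy, hz, hw⟩ := (Finset.mem_filter.1 hp).2
  refine Finset.mem_image.2 ⟨(xp, zp), by simp [hy, hz], ?_⟩
  simp only [g, hy, Option.getD_some, ← hw]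
  ext i <;> simp [firstR, lastC]

/-- For a good database pair with at most `t` entries each, at most
`t + 1` capacity strings have a tail, and there are at most `t·(t+1)` intermediate
pairs. -/
theorem good_few_tails_and_ips (r c : ℕ) (hr : 0 < r) (hc : 0 < c)
    (π : Equiv.Perm (Fin (r + c) → Bool)) (Dk Dk' : Database r c) (t : ℕ)
    (hgood : GoodDB π Dk Dk') (hk : dbSize Dk ≤ t) (hk' : dbSize Dk' ≤ t) :
    Nat.card {z : CapStr c // HasATail π Dk Dk' z} ≤ t + 1 ∧
    Nat.card {p : RateStr r × CapStr c // IsIP π Dk Dk' p.1 p.2} ≤ t * (t + 1) := by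
  have htails := (card_hasATail_le hgood.2).trans (Nat.add_le_add_right hk' 1)
  exact ⟨htails, (card_isIP_le π Dk Dk').trans (Nat.mul_le_mul hk htails)⟩
end

section
/- Fix positive integers r, c with n = r + c, M ∈ ℕ, and a permutation π of (Fin n → Bool) that is M-good. Let t ∈ ℕ, suppose (D_k, D_{k'}) is good with |D_k| ≤ t and |D_{k'}| ≤ t, and let x' be a rate string with x' ∉ D_{k'}. Then the set B of capacity strings y' causing a bad completion on x' satisfies |B| ≤ (t + 1) + t·(t² + 2t)·M. -/
/-- `π` is `M`-good: for all rate strings `x₁, x₂`, the number of capacity strings `z`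
with `π(x₁ ∥ z)` beginning with `x₂` is at most `M`. -/
def MGoodPerm {r c : ℕ} (π : Equiv.Perm (Fin (r + c) → Bool)) (M : ℕ) : Prop :=
  ∀ x₁ x₂ : RateStr r,
    Nat.card {z : CapStr c // firstR (π (Fin.append x₁ z)) = x₂} ≤ M

/-- `(x_i, z_i)` is one of the completed pairs of `(x', y')`: there is a capacity
string `y_i'` with `(x', y_i') ∈ IP(D_k, D_{k'})` and some `x ∈ D_k` with
`x_i ∥ z_i = π(x ∥ (y_i' ⊕ y' ⊕ D_k(x)))` (if no such `y_i'` exists, there are no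
completed pairs). -/
def IsCP {r c : ℕ} (π : Equiv.Perm (Fin (r + c) → Bool)) (Dk Dk' : Database r c)
    (x' : RateStr r) (y' : CapStr c) (xi : RateStr r) (zi : CapStr c) : Prop :=
  ∃ yi' : CapStr c, IsIP π Dk Dk' x' yi' ∧
    ∃ (x : RateStr r) (yx : CapStr c), Dk x = some yx ∧
      Fin.append xi zi = π (Fin.append x (capXor (capXor yi' y') yx))

/-- The image `y'` causes a bad completion on preimage `x'`: (1) some pair in
`CP_{(x',y')}` shares its first component with a pair in `IP(D_k, D_{k'})`; or (2)
some pair in `CP_{(x',y')}` has first component in `D_{k'}`; or (3) there is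
`(x', y_i') ∈ IP(D_k, D_{k'})` with `y_i' ⊕ y'` having a tail (in `(D_k, D_{k'})`). -/
def CausesBadCompletion {r c : ℕ} (π : Equiv.Perm (Fin (r + c) → Bool))
    (Dk Dk' : Database r c) (x' : RateStr r) (y' : CapStr c) : Prop :=
  (∃ (x₁ : RateStr r) (z₁ z₂ : CapStr c),
      IsCP π Dk Dk' x' y' x₁ z₁ ∧ IsIP π Dk Dk' x₁ z₂) ∨
  (∃ (x₁ : RateStr r) (z₁ : CapStr c),
      IsCP π Dk Dk' x' y' x₁ z₁ ∧ (Dk' x₁).isSome) ∨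
  (∃ yi' : CapStr c, IsIP π Dk Dk' x' yi' ∧ HasATail π Dk Dk' (capXor yi' y'))

theorem capXor_cancel_left {c : ℕ} (a b : CapStr c) : capXor a (capXor a b) = b := by
  funext i; simp [capXor]

theorem capXor_comm {c : ℕ} (a b : CapStr c) : capXor a b = capXor b a := by
  funext i; exact Bool.xor_comm _ _

theorem capXor_right_injective {c : ℕ} (a : CapStr c) : Function.Injective (capXor a) :=
  Function.LeftInverse.injective (capXor_cancel_left a)

theorem capXor_left_injective {c : ℕ} (b : CapStr c) :
    Function.Injective fun a : CapStr c => capXor a b := by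
  simpa only [capXor_comm _ b] using capXor_right_injective b

theorem firstR_append {r c : ℕ} (x : RateStr r) (z : CapStr c) :
    firstR (Fin.append x z) = x := by
  funext i; simp [firstR]

/-- The inputs on which a database is defined. -/
def dbDomain {r c : ℕ} (D : Database r c) : Finset (RateStr r) :=
  Finset.univ.filter fun x => (D x).isSome

theorem mem_dbDomain {r c : ℕ} {D : Database r c} {x : RateStr r} :
    x ∈ dbDomain D ↔ (D x).isSome := by
  simp [dbDomain]

open Classical in
/-- The capacity strings that have a tail. -/
noncomputable def tailed {r c : ℕ} (π : Equiv.Perm (Fin (r + c) → Bool))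
    (Dk Dk' : Database r c) : Finset (CapStr c) :=
  Finset.univ.filter (HasATail π Dk Dk')

open Classical in
/-- The rate strings that are first components of intermediate pairs. -/
noncomputable def ipFirsts {r c : ℕ} (π : Equiv.Perm (Fin (r + c) → Bool))
    (Dk Dk' : Database r c) : Finset (RateStr r) :=
  Finset.univ.filter fun x => ∃ z, IsIP π Dk Dk' x z

theorem HasATail.eq_zero_or_eq_capXor {r c : ℕ} {π : Equiv.Perm (Fin (r + c) → Bool)}
    {Dk Dk' : Database r c} {z : CapStr c} (h : HasATail π Dk Dk' z) :
    z = (fun _ => false) ∨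
      ∃ x zi y, IsIP π Dk Dk' x zi ∧ Dk' x = some y ∧ z = capXor zi y := by
  obtain ⟨s, hs⟩ := h
  cases hs with
  | zero => exact Or.inl rfl
  | step h hk hk' =>
    exact Or.inr ⟨_, _, _, ⟨_, _, _, hk, ⟨_, h⟩, append_firstR_lastC _⟩, hk', rfl⟩

theorem card_tailed_le {r c : ℕ} {π : Equiv.Perm (Fin (r + c) → Bool)}
    {Dk Dk' : Database r c} (hgood : GoodDB π Dk Dk') :
    (tailed π Dk Dk').card ≤ dbSize Dk' + 1 := by
  classical
  let g : RateStr r → CapStr c := fun x =>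
    if h : ∃ z, IsIP π Dk Dk' x z then capXor h.choose ((Dk' x).getD fun _ => false)
    else fun _ => false
  have hsub : tailed π Dk Dk' ⊆ insert (fun _ => false) ((dbDomain Dk').image g) := by
    intro z hz
    rw [tailed, Finset.mem_filter] at hz
    rw [Finset.mem_insert, Finset.mem_image]
    refine hz.2.eq_zero_or_eq_capXor.imp_right ?_
    rintro ⟨x, zi, y, hip, hy, rfl⟩
    have hex : ∃ z, IsIP π Dk Dk' x z := ⟨zi, hip⟩
    refine ⟨x, mem_dbDomain.2 (by simp [hy]), ?_⟩
    simp [g, dif_pos hex, hy, hgood.2 x _ _ hex.choose_spec hip]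
  exact (Finset.card_le_card hsub).trans
    ((Finset.card_insert_le _ _).trans (Nat.succ_le_succ Finset.card_image_le))

theorem card_ipFirsts_le {r c : ℕ} (π : Equiv.Perm (Fin (r + c) → Bool))
    (Dk Dk' : Database r c) :
    (ipFirsts π Dk Dk').card ≤ dbSize Dk * (tailed π Dk Dk').card := by
  classical
  have hsub : ipFirsts π Dk Dk' ⊆ (dbDomain Dk ×ˢ tailed π Dk Dk').image fun p =>
      firstR (π (Fin.append p.1 (capXor p.2 ((Dk p.1).getD fun _ => false)))) := by
    intro x hx
    rw [ipFirsts, Finset.mem_filter] at hx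
    obtain ⟨-, z, xp, yp, zp, hxp, hzp, heq⟩ := hx
    refine Finset.mem_image.2 ⟨(xp, zp), ?_, ?_⟩
    · simp [mem_dbDomain, hxp, tailed, hzp]
    · simp [hxp, ← heq, firstR_append]
  refine (Finset.card_le_card hsub).trans (Finset.card_image_le.trans ?_)
  rw [Finset.card_product]
  rfl

theorem MGoodPerm.card_filter_le {r c M : ℕ} {π : Equiv.Perm (Fin (r + c) → Bool)}
    (hπ : MGoodPerm π M) (x₁ x₂ : RateStr r) {f : CapStr c → CapStr c}
    (hf : Function.Injective f) :
    (Finset.univ.filter fun y => firstR (π (Fin.append x₁ (f y))) = x₂).card ≤ M := by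
  refine le_trans ?_ (hπ x₁ x₂)
  rw [Nat.card_eq_fintype_card, Fintype.card_subtype]
  exact Finset.card_le_card_of_injOn f (fun y hy => by simpa using hy) hf.injOn

theorem card_causesBadCompletion_le {r c M : ℕ} {π : Equiv.Perm (Fin (r + c) → Bool)}
    (hπ : MGoodPerm π M) {Dk Dk' : Database r c} (hgood : GoodDB π Dk Dk') (x' : RateStr r) :
    Nat.card {y' : CapStr c // CausesBadCompletion π Dk Dk' x' y'} ≤
      (tailed π Dk Dk').card +
        dbSize Dk * ((ipFirsts π Dk Dk').card + dbSize Dk') * M := by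
  classical
  rw [Nat.card_eq_fintype_card, Fintype.card_subtype]
  by_cases hex : ∃ w, IsIP π Dk Dk' x' w
  swap
  · rw [Finset.filter_false_of_mem]
    · simp
    · rintro y - (⟨_, _, _, ⟨w, hw, -⟩, -⟩ | ⟨_, _, ⟨w, hw, -⟩, -⟩ | ⟨w, hw, -⟩) <;>
        exact hex ⟨w, hw⟩
  obtain ⟨w, hw⟩ := hex
  let f : RateStr r → CapStr c → CapStr c := fun x y =>
    capXor (capXor w y) ((Dk x).getD fun _ => false)
  have hf (x : RateStr r) : Function.Injective (f x) :=
    (capXor_left_injective _).comp (capXor_right_injective w)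
  let pairs := dbDomain Dk ×ˢ (ipFirsts π Dk Dk' ∪ dbDomain Dk')
  let hits : RateStr r × RateStr r → Finset (CapStr c) := fun p =>
    Finset.univ.filter fun y => firstR (π (Fin.append p.1 (f p.1 y))) = p.2
  have hcp {y : CapStr c} {x₁ : RateStr r} {z₁ : CapStr c} (h : IsCP π Dk Dk' x' y x₁ z₁)
      (hx₁ : x₁ ∈ ipFirsts π Dk Dk' ∪ dbDomain Dk') : y ∈ pairs.biUnion hits := by
    obtain ⟨w', hw', x, yx, hx, heq⟩ := h
    obtain rfl := hgood.2 x' _ _ hw hw'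
    refine Finset.mem_biUnion.2 ⟨(x, x₁), Finset.mem_product.2 ⟨?_, hx₁⟩, ?_⟩
    · exact mem_dbDomain.2 (by simp [hx])
    · simp [hits, f, hx, ← heq, firstR_append]
  have hsub : (Finset.univ.filter fun y => CausesBadCompletion π Dk Dk' x' y) ⊆
      (tailed π Dk Dk').image (capXor w) ∪ pairs.biUnion hits := by
    intro y hy
    rw [Finset.mem_union]
    rcases (Finset.mem_filter.1 hy).2 with
      ⟨x₁, z₁, z₂, h, h₂⟩ | ⟨x₁, z₁, h, h₂⟩ | ⟨w', hw', ht⟩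
    · refine Or.inr (hcp h (Finset.mem_union_left _ ?_))
      rw [ipFirsts, Finset.mem_filter]
      exact ⟨Finset.mem_univ _, z₂, h₂⟩
    · exact Or.inr (hcp h (Finset.mem_union_right _ (mem_dbDomain.2 h₂)))
    · obtain rfl := hgood.2 x' _ _ hw hw'
      refine Or.inl (Finset.mem_image.2 ⟨capXor w y, ?_, capXor_cancel_left w y⟩)
      rw [tailed, Finset.mem_filter]
      exact ⟨Finset.mem_univ _, ht⟩
  refine (Finset.card_le_card hsub).trans ((Finset.card_union_le _ _).trans ?_)
  refine Nat.add_le_add Finset.card_image_le ?_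
  refine (Finset.card_biUnion_le_card_mul _ _ M fun p _ =>
    hπ.card_filter_le p.1 p.2 (hf p.1)).trans ?_
  rw [Finset.card_product]
  exact Nat.mul_le_mul_right _ (Nat.mul_le_mul_left _ (Finset.card_union_le _ _))

/-- For an `M`-good `π` and a good database pair with at most `t`
entries each, and any `x' ∉ D_{k'}`, at most `(t+1) + t·(t²+2t)·M` images `y'` cause
a bad completion on `x'`. -/
theorem few_bad_completion (r c : ℕ) (hr : 0 < r) (hc : 0 < c) (M : ℕ)
    (π : Equiv.Perm (Fin (r + c) → Bool)) (hπ : MGoodPerm π M)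
    (Dk Dk' : Database r c) (t : ℕ)
    (hgood : GoodDB π Dk Dk') (hk : dbSize Dk ≤ t) (hk' : dbSize Dk' ≤ t)
    (x' : RateStr r) (hx' : Dk' x' = none) :
    Nat.card {y' : CapStr c // CausesBadCompletion π Dk Dk' x' y'}
      ≤ (t + 1) + t * (t ^ 2 + 2 * t) * M := by
  have hT : (tailed π Dk Dk').card ≤ t + 1 :=
    (card_tailed_le hgood).trans (Nat.succ_le_succ hk')
  have hF : (ipFirsts π Dk Dk').card ≤ t * (t + 1) :=
    (card_ipFirsts_le π Dk Dk').trans (Nat.mul_le_mul hk hT)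
  calc _ ≤ _ := card_causesBadCompletion_le hπ hgood x'
    _ ≤ (t + 1) + t * (t * (t + 1) + t) * M := by gcongr
    _ = (t + 1) + t * (t ^ 2 + 2 * t) * M := by ring
end

section
/- With X a nonempty finite type, Y a nontrivial finite abelian group, and the operators C, C^x, L, P on H = ℂ^X ⊗ ℂ^Y ⊗ F defined as in the context: (I_X ⊗ I_Y ⊗ C) ∘ P ∘ (I_X ⊗ I_Y ⊗ C) = L ∘ P ∘ L as linear operators on H. Moreover, each C^x is self-inverse, so (I_X ⊗ I_Y ⊗ C) equals its own inverse and the left-hand side also equals (I_X ⊗ I_Y ⊗ C) ∘ P ∘ (I_X ⊗ I_Y ⊗ C)⁻¹. -/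
/-! Compressed oracle operators on the purified oracle space.

We work with the coordinate representation: a vector of the Hilbert space
`ℂ^X ⊗ ℂ^Y ⊗ F` (where `F` has orthonormal basis indexed by `X → Option Y`,
with `none` playing the role of `⊥`) is its coefficient function on the
computational basis, i.e. an element of `X × Y × (X → Option Y) → ℂ`. -/

variable (X Y : Type*)

/-- The purified-oracle state space `ℂ^X ⊗ ℂ^Y ⊗ F` in coordinates. -/
abbrev HSp := X × Y × (X → Option Y) → ℂ

variable [Fintype X] [Fintype Y] [DecidableEq X] [DecidableEq Y] [AddCommGroup Y]

/-- Matrix entries of the single-register compression operator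
`c = I − |⊥⟩⟨⊥| − |μ⟩⟨μ| + |⊥⟩⟨μ| + |μ⟩⟨⊥|` on `ℂ^(Y ∪ {⊥})`,
where `|μ⟩ = |Y|^{-1/2} ∑_{y ∈ Y} |y⟩`. -/
noncomputable def cmat : Option Y → Option Y → ℂ
  | some a, some b => (if a = b then 1 else 0) - (Fintype.card Y : ℂ)⁻¹
  | some _, none => (Real.sqrt (Fintype.card Y) : ℝ)⁻¹
  | none, some _ => (Real.sqrt (Fintype.card Y) : ℝ)⁻¹
  | none, none => 0

variable {X Y}

/-- The compression operator `I_X ⊗ I_Y ⊗ C^{x₀}` applying `c` to the `x₀`-th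
register of the function space. -/
noncomputable def Cx (x₀ : X) : HSp X Y →ₗ[ℂ] HSp X Y where
  toFun ψ := fun p =>
    ∑ v : Option Y, cmat Y (p.2.2 x₀) v * ψ (p.1, p.2.1, Function.update p.2.2 x₀ v)
  map_add' ψ φ := by
    funext p
    simp only [Pi.add_apply, mul_add, Finset.sum_add_distrib]
  map_smul' a ψ := by
    funext p
    simp only [Pi.smul_apply, smul_eq_mul, RingHom.id_apply, Finset.mul_sum]
    exact Finset.sum_congr rfl fun v _ => by ring

/-- The full compression operator `I_X ⊗ I_Y ⊗ C` with `C = ∏_{x ∈ X} C^x`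
(matrix entries `⟨g|C|f⟩ = ∏_x ⟨g x|c|f x⟩`). -/
noncomputable def Cop : HSp X Y →ₗ[ℂ] HSp X Y where
  toFun ψ := fun p =>
    ∑ g : X → Option Y, (∏ x : X, cmat Y (p.2.2 x) (g x)) * ψ (p.1, p.2.1, g)
  map_add' ψ φ := by
    funext p
    simp only [Pi.add_apply, mul_add, Finset.sum_add_distrib]
  map_smul' a ψ := by
    funext p
    simp only [Pi.smul_apply, smul_eq_mul, RingHom.id_apply, Finset.mul_sum]
    exact Finset.sum_congr rfl fun g _ => by ring

/-- The controlled (local) compression operator `L`, applying `c` to the register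
selected by the input (`X`) component. -/
noncomputable def Lop : HSp X Y →ₗ[ℂ] HSp X Y where
  toFun ψ := fun p =>
    ∑ v : Option Y, cmat Y (p.2.2 p.1) v * ψ (p.1, p.2.1, Function.update p.2.2 p.1 v)
  map_add' ψ φ := by
    funext p
    simp only [Pi.add_apply, mul_add, Finset.sum_add_distrib]
  map_smul' a ψ := by
    funext p
    simp only [Pi.smul_apply, smul_eq_mul, RingHom.id_apply, Finset.mul_sum]
    exact Finset.sum_congr rfl fun v _ => by ring

/-- The purified oracle `P`: `P|x,y,f⟩ = |x, y + f(x), f⟩` when `f(x) ∈ Y`, and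
`P|x,y,f⟩ = |x,y,f⟩` when `f(x) = ⊥` (in coordinates). -/
def Pop : HSp X Y →ₗ[ℂ] HSp X Y where
  toFun ψ := fun p => ψ (p.1, p.2.1 - (p.2.2 p.1).getD 0, p.2.2)
  map_add' _ _ := rfl
  map_smul' _ _ := rfl

section RegisterOp

variable {X Y : Type*} [Fintype X] [Fintype Y] [DecidableEq X]

/-- The operator on `HSp X Y` which, on the branch with input `x`, applies the matrix `M x z` to
the `z`-th register of the function space. -/
noncomputable def registerOp (M : X → X → Matrix (Option Y) (Option Y) ℂ) :
    HSp X Y →ₗ[ℂ] HSp X Y where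
  toFun ψ := fun p =>
    ∑ g : X → Option Y, (∏ z : X, M p.1 z (p.2.2 z) (g z)) * ψ (p.1, p.2.1, g)
  map_add' ψ φ := by
    funext p
    simp only [Pi.add_apply, mul_add, Finset.sum_add_distrib]
  map_smul' a ψ := by
    funext p
    simp only [Pi.smul_apply, smul_eq_mul, RingHom.id_apply, Finset.mul_sum]
    exact Finset.sum_congr rfl fun g _ => by ring

theorem registerOp_apply (M : X → X → Matrix (Option Y) (Option Y) ℂ) (ψ : HSp X Y)
    (x : X) (y : Y) (f : X → Option Y) :
    registerOp M ψ (x, y, f) = ∑ g : X → Option Y, (∏ z : X, M x z (f z) (g z)) * ψ (x, y, g) :=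
  rfl

theorem registerOp_comp (M N : X → X → Matrix (Option Y) (Option Y) ℂ) :
    registerOp M ∘ₗ registerOp N = registerOp (M * N) := by
  refine LinearMap.ext fun ψ => funext fun ⟨x, y, f⟩ => ?_
  simp only [LinearMap.comp_apply, registerOp_apply, Pi.mul_apply, Matrix.mul_apply,
    Finset.mul_sum]
  rw [Finset.sum_comm]
  refine Finset.sum_congr rfl fun h _ => ?_
  rw [Fintype.prod_sum, Finset.sum_mul]
  refine Finset.sum_congr rfl fun g _ => ?_
  rw [Finset.prod_mul_distrib, mul_assoc]

variable [DecidableEq Y]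

theorem cmat_mul_cmat [Nonempty Y] : Matrix.of (cmat Y) * Matrix.of (cmat Y) = 1 := by
  have hn : (Fintype.card Y : ℂ) ≠ 0 := by exact_mod_cast Fintype.card_ne_zero
  have hs : ((Real.sqrt (Fintype.card Y) : ℝ) : ℂ)⁻¹ * ((Real.sqrt (Fintype.card Y) : ℝ) : ℂ)⁻¹
      = (Fintype.card Y : ℂ)⁻¹ := by
    rw [← mul_inv, ← Complex.ofReal_mul, Real.mul_self_sqrt (Nat.cast_nonneg _),
      Complex.ofReal_natCast]
  ext (_ | a) (_ | b)
  · simp [Matrix.mul_apply, cmat, hs, hn]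
  · simp [Matrix.mul_apply, cmat, ← Finset.mul_sum, hn]
  · simp [Matrix.mul_apply, cmat, ← Finset.sum_mul, hn]
  · simp [Matrix.mul_apply, cmat, hs, mul_sub, sub_mul, hn, Matrix.one_apply,
      Finset.sum_sub_distrib]

/-- Applying the identity to all registers but the `w`-th one amounts to summing over the values
of that register. -/
theorem sum_prod_single_register (K : Matrix (Option Y) (Option Y) ℂ) (w : X)
    (f : X → Option Y) (φ : (X → Option Y) → ℂ) :
    ∑ g : X → Option Y,
        (∏ z : X, (Pi.mulSingle w K : X → Matrix _ _ ℂ) z (f z) (g z)) * φ g =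
      ∑ v : Option Y, K (f w) v * φ (Function.update f w v) := by
  symm
  refine Finset.sum_of_injOn (Function.update f w) (Function.update_injective f w).injOn
    (fun _ _ => Finset.mem_coe.2 (Finset.mem_univ _)) (fun g _ hg => ?_) (fun v _ => ?_)
  · obtain ⟨z, hzw, hz⟩ : ∃ z, z ≠ w ∧ f z ≠ g z := by
      by_contra! h
      refine hg ⟨g w, by simp, ?_⟩
      ext1 z
      by_cases hz : z = w
      · subst hz; simp
      · rw [Function.update_of_ne hz, h z hz]
    rw [Finset.prod_eq_zero (Finset.mem_univ z), zero_mul]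
    rw [Pi.mulSingle_eq_of_ne hzw, Matrix.one_apply_ne hz]
  · rw [Finset.prod_eq_single w (fun z _ hz => ?_) (by simp)]
    · simp
    · rw [Pi.mulSingle_eq_of_ne hz, Function.update_of_ne hz, Matrix.one_apply_eq]

theorem registerOp_one : registerOp (1 : X → X → Matrix (Option Y) (Option Y) ℂ) =
    LinearMap.id := by
  refine LinearMap.ext fun ψ => funext fun ⟨x, y, f⟩ => ?_
  simpa [registerOp_apply, Matrix.one_apply] using
    sum_prod_single_register 1 x f (fun g => ψ (x, y, g))

theorem Cx_eq_registerOp (w : X) :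
    (Cx w : HSp X Y →ₗ[ℂ] HSp X Y) =
      registerOp fun _ => Pi.mulSingle w (Matrix.of (cmat Y)) := by
  refine LinearMap.ext fun ψ => funext fun ⟨x, y, f⟩ => ?_
  exact (sum_prod_single_register (Matrix.of (cmat Y)) w f (fun g => ψ (x, y, g))).symm

theorem Lop_eq_registerOp :
    (Lop : HSp X Y →ₗ[ℂ] HSp X Y) =
      registerOp fun x => Pi.mulSingle x (Matrix.of (cmat Y)) := by
  refine LinearMap.ext fun ψ => funext fun ⟨x, y, f⟩ => ?_
  exact (sum_prod_single_register (Matrix.of (cmat Y)) x f (fun g => ψ (x, y, g))).symm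

theorem Cop_eq_registerOp :
    (Cop : HSp X Y →ₗ[ℂ] HSp X Y) = registerOp fun _ _ => Matrix.of (cmat Y) :=
  rfl

variable [AddCommGroup Y]

/-- The purified oracle commutes with operators that leave the queried register untouched. -/
theorem Pop_comp_registerOp (M : X → X → Matrix (Option Y) (Option Y) ℂ)
    (hM : ∀ x, M x x = 1) : Pop ∘ₗ registerOp M = registerOp M ∘ₗ Pop := by
  refine LinearMap.ext fun ψ => funext fun ⟨x, y, f⟩ => ?_
  change ∑ g : X → Option Y, (∏ z : X, M x z (f z) (g z)) * ψ (x, y - (f x).getD 0, g) =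
    ∑ g : X → Option Y, (∏ z : X, M x z (f z) (g z)) * ψ (x, y - (g x).getD 0, g)
  refine Finset.sum_congr rfl fun g _ => ?_
  by_cases h : f x = g x
  · rw [h]
  · rw [Finset.prod_eq_zero (Finset.mem_univ x) (by rw [hM, Matrix.one_apply_ne h]), zero_mul,
      zero_mul]

end RegisterOp

/-- `(I⊗I⊗C) ∘ P ∘ (I⊗I⊗C) = L ∘ P ∘ L`; moreover each `C^x` is
self-inverse, so `I⊗I⊗C` equals its own inverse (hence the left-hand side also
equals `(I⊗I⊗C) ∘ P ∘ (I⊗I⊗C)⁻¹`). -/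
theorem compress_conjugation_eq_local {X Y : Type*} [Fintype X] [Fintype Y]
    [DecidableEq X] [DecidableEq Y] [AddCommGroup Y] [Nonempty X] [Nontrivial Y] :
    (Cop ∘ₗ Pop ∘ₗ Cop : HSp X Y →ₗ[ℂ] HSp X Y) = Lop ∘ₗ Pop ∘ₗ Lop ∧
    (∀ x₀ : X, (Cx x₀ ∘ₗ Cx x₀ : HSp X Y →ₗ[ℂ] HSp X Y) = LinearMap.id) ∧
    (Cop ∘ₗ Cop : HSp X Y →ₗ[ℂ] HSp X Y) = LinearMap.id := by
  have hc := cmat_mul_cmat (Y := Y)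
  have hC : (Cop ∘ₗ Cop : HSp X Y →ₗ[ℂ] HSp X Y) = LinearMap.id := by
    rw [Cop_eq_registerOp, registerOp_comp, ← registerOp_one]
    congr 1
    funext x z
    exact hc
  refine ⟨?_, fun w => ?_, hC⟩
  · set N : X → X → Matrix (Option Y) (Option Y) ℂ :=
      fun x z => if z = x then 1 else Matrix.of (cmat Y) with hN
    have hLN : (Lop ∘ₗ registerOp N : HSp X Y →ₗ[ℂ] HSp X Y) = Cop := by
      rw [Lop_eq_registerOp, Cop_eq_registerOp, registerOp_comp]
      congr 1
      funext x z
      by_cases h : z = x <;> simp [hN, h]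
    have hNL : (registerOp N ∘ₗ Lop : HSp X Y →ₗ[ℂ] HSp X Y) = Cop := by
      rw [Lop_eq_registerOp, Cop_eq_registerOp, registerOp_comp]
      congr 1
      funext x z
      by_cases h : z = x <;> simp [hN, h]
    have hNN : registerOp N ∘ₗ registerOp N = LinearMap.id := by
      rw [registerOp_comp, ← registerOp_one]
      congr 1
      funext x z
      by_cases h : z = x <;> simp [hN, h, hc]
    calc (Cop ∘ₗ Pop ∘ₗ Cop : HSp X Y →ₗ[ℂ] HSp X Y)
        = Lop ∘ₗ (registerOp N ∘ₗ Pop) ∘ₗ registerOp N ∘ₗ Lop := by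
          rw [hNL, ← hLN]; rfl
      _ = Lop ∘ₗ Pop ∘ₗ (registerOp N ∘ₗ registerOp N) ∘ₗ Lop := by
          rw [← Pop_comp_registerOp N (by simp [hN])]; rfl
      _ = Lop ∘ₗ Pop ∘ₗ Lop := by rw [hNN, LinearMap.id_comp]
  · rw [Cx_eq_registerOp, registerOp_comp, ← registerOp_one]
    congr 1
    funext x
    change (Pi.mulSingle w (Matrix.of (cmat Y)) * Pi.mulSingle w (Matrix.of (cmat Y)) :
      X → Matrix (Option Y) (Option Y) ℂ) = 1
    rw [← Pi.mulSingle_mul, hc, Pi.mulSingle_one]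
end

section
/- With X a nonempty finite type, Y a nontrivial finite abelian group, and H, C^x, L, P as in the context, let cO = L ∘ P ∘ L. Call a vector ψ ∈ H 'valid' if for every x₀ ∈ X, the component of (I_X ⊗ I_Y ⊗ C^{x₀}) ψ on the span of the basis vectors |x⟩⊗|y⟩⊗|f⟩ with f(x₀) = ⊥ is zero. Then cO maps valid vectors to valid vectors. -/
/-! Compressed oracle operators on the purified oracle space.

We work with the coordinate representation: a vector of the Hilbert space
`ℂ^X ⊗ ℂ^Y ⊗ F` (where `F` has orthonormal basis indexed by `X → Option Y`,
with `none` playing the role of `⊥`) is its coefficient function on the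
computational basis, i.e. an element of `X × Y × (X → Option Y) → ℂ`. -/

variable (X Y : Type*)

variable [Fintype X] [Fintype Y] [DecidableEq X] [DecidableEq Y] [AddCommGroup Y]

variable {X Y}

/-- A vector `ψ` of `ℂ^X ⊗ ℂ^Y ⊗ F` is valid: for every `x₀ ∈ X`, the component of
`(I⊗I⊗C^{x₀}) ψ` on the span of basis vectors `|x,y,f⟩` with `f(x₀) = ⊥` is zero. -/
def ValidVec {X Y : Type*} [Fintype X] [Fintype Y] [DecidableEq X] [DecidableEq Y]
    [AddCommGroup Y] (ψ : HSp X Y) : Prop :=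
  ∀ (x₀ : X) (p : X × Y × (X → Option Y)), p.2.2 x₀ = none → Cx x₀ ψ p = 0

/-- The single-register compression operator is an involution. -/
theorem sum_cmat_mul_cmat (a b : Option Y) :
    ∑ v : Option Y, cmat Y a v * cmat Y v b = if a = b then 1 else 0 := by
  have hcard : (Fintype.card Y : ℂ) ≠ 0 := Nat.cast_ne_zero.mpr Fintype.card_ne_zero
  have hsqrt : ((Real.sqrt (Fintype.card Y) : ℝ) : ℂ)⁻¹ * ((Real.sqrt (Fintype.card Y) : ℝ) : ℂ)⁻¹
      = (Fintype.card Y : ℂ)⁻¹ := by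
    rw [← mul_inv, ← Complex.ofReal_mul, Real.mul_self_sqrt (Nat.cast_nonneg _),
      Complex.ofReal_natCast]
  rw [Fintype.sum_option]
  rcases a with _ | a <;> rcases b with _ | b
  · simp [cmat, hsqrt, hcard]
  · simp [cmat, mul_sub, Finset.sum_sub_distrib]
    field_simp
    simp
  · simp [cmat, sub_mul, Finset.sum_sub_distrib, hcard]
  · simp [cmat, hsqrt, sub_mul, mul_sub, Finset.sum_sub_distrib, hcard]

omit [Fintype X] in
theorem Cx_involutive (x₀ : X) (ψ : HSp X Y) : Cx x₀ (Cx x₀ ψ) = ψ := by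
  funext ⟨x, y, f⟩
  simp only [Cx, LinearMap.coe_mk, AddHom.coe_mk, Function.update_self, Function.update_idem,
    Finset.mul_sum]
  rw [Finset.sum_comm]
  simp only [← mul_assoc, ← Finset.sum_mul, sum_cmat_mul_cmat, ite_mul, one_mul, zero_mul,
    Finset.sum_ite_eq, Finset.mem_univ, if_true, Function.update_eq_self]

omit [Fintype X] [AddCommGroup Y] in
theorem Lop_apply_eq_Cx (ψ : HSp X Y) (x : X) (y : Y) (f : X → Option Y) :
    Lop ψ (x, y, f) = Cx x ψ (x, y, f) := rfl

omit [Fintype X] [AddCommGroup Y] in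
theorem Cx_congr {ψ φ : HSp X Y} (x₀ x : X) (h : ∀ y f, ψ (x, y, f) = φ (x, y, f))
    (y : Y) (f : X → Option Y) : Cx x₀ ψ (x, y, f) = Cx x₀ φ (x, y, f) :=
  Finset.sum_congr rfl fun _ _ => by rw [h]

omit [Fintype X] [AddCommGroup Y] in
theorem Cx_Lop_of_ne (ψ : HSp X Y) {x₀ x : X} (h : x ≠ x₀) (y : Y) (f : X → Option Y) :
    Cx x₀ (Lop ψ) (x, y, f) = Lop (Cx x₀ ψ) (x, y, f) := by
  simp only [Cx, Lop, LinearMap.coe_mk, AddHom.coe_mk, Finset.mul_sum,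
    Function.update_of_ne h, Function.update_of_ne h.symm]
  rw [Finset.sum_comm]
  refine Finset.sum_congr rfl fun v _ => Finset.sum_congr rfl fun w _ => ?_
  rw [Function.update_comm h]
  ring

omit [Fintype X] in
theorem Cx_Pop_of_ne (ψ : HSp X Y) {x₀ x : X} (h : x ≠ x₀) (y : Y) (f : X → Option Y) :
    Cx x₀ (Pop ψ) (x, y, f) = Pop (Cx x₀ ψ) (x, y, f) := by
  simp only [Cx, Pop, LinearMap.coe_mk, AddHom.coe_mk, Function.update_of_ne h]

omit [Fintype X] [AddCommGroup Y] in
theorem Lop_eq_zero_of_ne {φ : HSp X Y} {x₀ x : X} (h : x ≠ x₀)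
    (hφ : ∀ y f, f x₀ = none → φ (x, y, f) = 0) (y : Y) (f : X → Option Y) (hf : f x₀ = none) :
    Lop φ (x, y, f) = 0 :=
  Finset.sum_eq_zero fun v _ => by
    rw [hφ y _ ((Function.update_of_ne h.symm _ _).trans hf), mul_zero]

/-- The compressed oracle `cO = L ∘ P ∘ L` maps
valid vectors to valid vectors. -/
theorem cO_preserves_valid {X Y : Type*} [Fintype X] [Fintype Y]
    [DecidableEq X] [DecidableEq Y] [AddCommGroup Y] [Nonempty X] [Nontrivial Y]
    (ψ : HSp X Y) (hψ : ValidVec ψ) :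
    ValidVec ((Lop ∘ₗ Pop ∘ₗ Lop : HSp X Y →ₗ[ℂ] HSp X Y) ψ) := by
  rintro x₀ ⟨x, y, f⟩ hf
  change f x₀ = none at hf
  change Cx x₀ (Lop (Pop (Lop ψ))) (x, y, f) = 0
  rcases eq_or_ne x x₀ with rfl | hx
  · rw [Cx_congr x x (Lop_apply_eq_Cx (Pop (Lop ψ)) x), Cx_involutive]
    exact hψ x (x, y - (f x).getD 0, f) hf
  · rw [Cx_Lop_of_ne _ hx]
    refine Lop_eq_zero_of_ne hx (fun y f hf => ?_) y f hf
    rw [Cx_Pop_of_ne _ hx]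
    change Cx x₀ (Lop ψ) (x, y - (f x).getD 0, f) = 0
    rw [Cx_Lop_of_ne _ hx]
    exact Lop_eq_zero_of_ne hx (fun y f hf => hψ x₀ (x, y, f) hf) _ f hf
end

section
/- With X a nonempty finite type, Y a nontrivial finite abelian group, and H, C^x, L, P as in the context, let cO = L ∘ P ∘ L. For t ∈ ℕ, let H_{≤t} denote the span of the basis vectors |x⟩⊗|y⟩⊗|f⟩ of H with |{x' ∈ X : f(x') ≠ ⊥}| ≤ t. Then cO maps H_{≤t} into H_{≤ t+1}. In particular, any state obtained from an initial state in H_{≤0} by t applications of cO interleaved with unitaries acting only on the ℂ^X ⊗ ℂ^Y factors lies in H_{≤t}. -/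
/-! Compressed oracle operators on the purified oracle space.

We work with the coordinate representation: a vector of the Hilbert space
`ℂ^X ⊗ ℂ^Y ⊗ F` (where `F` has orthonormal basis indexed by `X → Option Y`,
with `none` playing the role of `⊥`) is its coefficient function on the
computational basis, i.e. an element of `X × Y × (X → Option Y) → ℂ`. -/

variable (X Y : Type*)

variable [Fintype X] [Fintype Y] [DecidableEq X] [DecidableEq Y] [AddCommGroup Y]

variable {X Y}

/-- Membership in `H_{≤t}`: `ψ` is supported on basis vectors `|x,y,f⟩` where `f`
has at most `t` non-`⊥` outputs. -/
def InHle {X Y : Type*} [Fintype X] [Fintype Y] [DecidableEq X] [DecidableEq Y]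
    [AddCommGroup Y] (t : ℕ) (ψ : HSp X Y) : Prop :=
  ∀ p : X × Y × (X → Option Y),
    t < (Finset.univ.filter fun x' => (p.2.2 x').isSome).card → ψ p = 0

/-- An operator on `ℂ^X ⊗ ℂ^Y ⊗ F` acting only on the `ℂ^X ⊗ ℂ^Y` factors, i.e.
of the form `u ⊗ I_F` for some kernel `u` on `X × Y`. -/
def ActsOnXY {X Y : Type*} [Fintype X] [Fintype Y] [DecidableEq X] [DecidableEq Y]
    [AddCommGroup Y] (U : HSp X Y →ₗ[ℂ] HSp X Y) : Prop :=
  ∃ u : (X × Y) → (X × Y) → ℂ, ∀ (ψ : HSp X Y) (p : X × Y × (X → Option Y)),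
    U ψ p = ∑ q : X × Y, u (p.1, p.2.1) q * ψ (q.1, q.2, p.2.2)

/-- `ψ` is supported on basis vectors `|x,y,f⟩` where `f` has at most `t` non-`⊥` outputs
away from the queried input `x`. -/
def SupportedOffQuery (t : ℕ) (ψ : HSp X Y) : Prop :=
  ∀ p : X × Y × (X → Option Y),
    t < ((Finset.univ.erase p.1).filter fun x' => (p.2.2 x').isSome).card → ψ p = 0

theorem InHle.supportedOffQuery {t : ℕ} {ψ : HSp X Y} (h : InHle t ψ) :
    SupportedOffQuery t ψ := fun p hp =>
  h p (hp.trans_le (Finset.card_le_card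
    (Finset.filter_subset_filter _ (Finset.erase_subset _ _))))

theorem SupportedOffQuery.inHle_succ {t : ℕ} {ψ : HSp X Y} (h : SupportedOffQuery t ψ) :
    InHle (t + 1) ψ := by
  intro p hp
  refine h p ?_
  rw [Finset.filter_erase]
  have := Finset.pred_card_le_card_erase
    (s := Finset.univ.filter fun x' => (p.2.2 x').isSome) (a := p.1)
  omega

theorem SupportedOffQuery.apply_Lop {t : ℕ} {ψ : HSp X Y} (h : SupportedOffQuery t ψ) :
    SupportedOffQuery t (Lop ψ) := by
  intro p hp
  refine Finset.sum_eq_zero fun v _ => mul_eq_zero_of_right _ (h _ ?_)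
  refine hp.trans_eq (congrArg Finset.card (Finset.filter_congr fun x' hx' => ?_))
  simp [Function.update_of_ne (Finset.ne_of_mem_erase hx')]

theorem SupportedOffQuery.apply_Pop {t : ℕ} {ψ : HSp X Y} (h : SupportedOffQuery t ψ) :
    SupportedOffQuery t (Pop ψ) := fun p hp =>
  h (p.1, p.2.1 - (p.2.2 p.1).getD 0, p.2.2) hp

theorem InHle.compressedOracle {t : ℕ} {ψ : HSp X Y} (h : InHle t ψ) :
    InHle (t + 1) ((Lop ∘ₗ Pop ∘ₗ Lop : HSp X Y →ₗ[ℂ] HSp X Y) ψ) :=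
  h.supportedOffQuery.apply_Lop.apply_Pop.apply_Lop.inHle_succ

theorem InHle.of_actsOnXY {t : ℕ} {ψ : HSp X Y} (h : InHle t ψ)
    {U : HSp X Y →ₗ[ℂ] HSp X Y} (hU : ActsOnXY U) : InHle t (U ψ) := by
  obtain ⟨u, hu⟩ := hU
  intro p hp
  rw [hu]
  exact Finset.sum_eq_zero fun q _ => mul_eq_zero_of_right _ (h (q.1, q.2, p.2.2) hp)

/-- The compressed oracle `cO = L ∘ P ∘ L` maps `H_{≤t}` into
`H_{≤t+1}`; in particular, any state obtained from an initial state in `H_{≤0}` by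
`t` applications of `cO` interleaved with operators acting only on the
`ℂ^X ⊗ ℂ^Y` factors lies in `H_{≤t}`. -/
theorem cO_database_growth {X Y : Type*} [Fintype X] [Fintype Y]
    [DecidableEq X] [DecidableEq Y] [AddCommGroup Y] [Nonempty X] [Nontrivial Y] :
    (∀ (t : ℕ) (ψ : HSp X Y), InHle t ψ →
      InHle (t + 1) ((Lop ∘ₗ Pop ∘ₗ Lop : HSp X Y →ₗ[ℂ] HSp X Y) ψ)) ∧
    (∀ (t : ℕ) (U : ℕ → (HSp X Y →ₗ[ℂ] HSp X Y)), (∀ i, ActsOnXY (U i)) →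
      ∀ ψ₀ : HSp X Y, InHle 0 ψ₀ →
        InHle t ((List.range t).foldl
          (fun ψ i => (Lop ∘ₗ Pop ∘ₗ Lop : HSp X Y →ₗ[ℂ] HSp X Y) (U i ψ)) ψ₀)) := by
  refine ⟨fun t ψ h => h.compressedOracle, fun t U hU ψ₀ h₀ => ?_⟩
  induction t with
  | zero => exact h₀
  | succ t ih =>
    rw [List.range_succ, List.foldl_append]
    exact (ih.of_actsOnXY (hU t)).compressedOracle
end
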